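/- arXiv:2008.09754 — 2 statements merged into one kernel-verified Lean document; each statement's English description precedes it below -/
import Mathlib

section
/- For all integers h ≥ m ≥ n ≥ 1, the spider Sp(2n, 2m, 2h) with three even legs has local antimagic chromatic number 4. -/
open SimpleGraph

/-- The induced vertex sum of an edge labeling. -/
noncomputable def vertexSum {V : Type*} (G : SimpleGraph V) (f : Sym2 V → ℕ) (x : V) : ℕ :=
  ∑ᶠ y ∈ G.neighborSet x, f s(x, y)

/-- `f` is a local antimagic labeling of `G`. -/
def IsLocalAntimagic {V : Type*} (G : SimpleGraph V) (f : Sym2 V → ℕ) : Prop :=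
  Set.BijOn f G.edgeSet (Set.Icc 1 G.edgeSet.ncard) ∧
  ∀ ⦃x y : V⦄, G.Adj x y → vertexSum G f x ≠ vertexSum G f y

/-- The number of distinct induced vertex labels of `f`. -/
noncomputable def colorCount {V : Type*} (G : SimpleGraph V) (f : Sym2 V → ℕ) : ℕ :=
  (Set.range (vertexSum G f)).ncard

/-- The local antimagic chromatic number. -/
noncomputable def chiLA {V : Type*} (G : SimpleGraph V) : ℕ :=
  sInf {n | ∃ f : Sym2 V → ℕ, IsLocalAntimagic G f ∧ colorCount G f = n}

/-- A pendant vertex: a vertex of degree 1. -/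
def IsPendant {V : Type*} (G : SimpleGraph V) (x : V) : Prop :=
  (G.neighborSet x).ncard = 1

/-- A pendant edge: an edge incident to a pendant vertex. -/
def IsPendantEdge {V : Type*} (G : SimpleGraph V) (e : Sym2 V) : Prop :=
  e ∈ G.edgeSet ∧ ∃ x ∈ e, IsPendant G x

/-- The spider graph with `d` legs of lengths `y i`: the core is `none`, and leg `i`
consists of vertices `some ⟨i, j⟩` for `j : Fin (y i)`, forming a path from the core. -/
def spider (d : ℕ) (y : Fin d → ℕ) : SimpleGraph (Option (Σ i : Fin d, Fin (y i))) :=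
  SimpleGraph.fromRel (fun u v =>
    ∃ (i : Fin d) (j : Fin (y i)), (u = none ∧ v = some ⟨i, j⟩ ∧ (j : ℕ) = 0) ∨
      (∃ k : Fin (y i), u = some ⟨i, j⟩ ∧ v = some ⟨i, k⟩ ∧ (j : ℕ) + 1 = (k : ℕ)))

namespace Spider

/-- The neighbor of a non-core vertex lying one step closer to the core. -/
def parent {d : ℕ} {y : Fin d → ℕ} (p : Σ i : Fin d, Fin (y i)) :
    Option (Σ i : Fin d, Fin (y i)) :=
  if h : (p.2 : ℕ) = 0 then none else some ⟨p.1, ⟨p.2 - 1, by omega⟩⟩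

/-- The edge joining a non-core vertex to its parent. -/
def edge {d : ℕ} {y : Fin d → ℕ} (p : Σ i : Fin d, Fin (y i)) :
    Sym2 (Option (Σ i : Fin d, Fin (y i))) :=
  s(some p, parent p)

variable {d : ℕ} {y : Fin d → ℕ}

theorem parent_zero {i : Fin d} (h : 0 < y i) : parent (⟨i, ⟨0, h⟩⟩ : Σ i, Fin (y i)) = none := by
  simp [parent]

theorem parent_succ {i : Fin d} {j : ℕ} (h : j + 1 < y i) :
    parent (⟨i, ⟨j + 1, h⟩⟩ : Σ i, Fin (y i)) = some ⟨i, ⟨j, by omega⟩⟩ := by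
  simp [parent]

theorem adj_iff {a b : Option (Σ i, Fin (y i))} :
    (spider d y).Adj a b ↔ ∃ p, (a = some p ∧ b = parent p) ∨ (b = some p ∧ a = parent p) := by
  have key : ∀ u v : Option (Σ i, Fin (y i)),
      (∃ (i : Fin d) (j : Fin (y i)), (u = none ∧ v = some ⟨i, j⟩ ∧ (j : ℕ) = 0) ∨
        (∃ k : Fin (y i), u = some ⟨i, j⟩ ∧ v = some ⟨i, k⟩ ∧ (j : ℕ) + 1 = (k : ℕ))) ↔
      ∃ p, v = some p ∧ u = parent p := by
    intro u v
    constructor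
    · rintro ⟨i, j, ⟨rfl, rfl, hj⟩ | ⟨k, rfl, rfl, hk⟩⟩
      · exact ⟨_, rfl, by simp [parent, hj]⟩
      · obtain ⟨k, hk'⟩ := k
        obtain rfl : k = j + 1 := hk.symm
        exact ⟨_, rfl, (parent_succ hk').symm⟩
    · rintro ⟨⟨i, ⟨j, hj⟩⟩, rfl, rfl⟩
      rcases j with _ | j
      · exact ⟨i, ⟨0, hj⟩, Or.inl ⟨parent_zero hj, rfl, rfl⟩⟩
      · exact ⟨i, ⟨j, by omega⟩, Or.inr ⟨⟨j + 1, hj⟩, parent_succ hj, rfl, rfl⟩⟩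
  have hne : ∀ p : Σ i, Fin (y i), some p ≠ parent p := by
    rintro ⟨i, ⟨_ | j, hj⟩⟩
    · simp [parent]
    · simp [parent_succ]
  rw [spider, SimpleGraph.fromRel_adj, key, key, ← exists_or]
  constructor
  · rintro ⟨-, p, hp⟩
    exact ⟨p, hp.symm⟩
  · rintro ⟨p, ⟨rfl, rfl⟩ | ⟨rfl, rfl⟩⟩
    · exact ⟨hne p, p, Or.inr ⟨rfl, rfl⟩⟩
    · exact ⟨(hne p).symm, p, Or.inl ⟨rfl, rfl⟩⟩

theorem adj_parent (p : Σ i, Fin (y i)) : (spider d y).Adj (some p) (parent p) :=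
  adj_iff.2 ⟨p, Or.inl ⟨rfl, rfl⟩⟩

theorem parent_parent_ne {p q : Σ i, Fin (y i)} (h : some p = parent q) : some q ≠ parent p := by
  obtain ⟨i, ⟨_ | j, hj⟩⟩ := q
  · simp [parent] at h
  · rw [parent_succ, Option.some_inj] at h
    subst h
    obtain _ | j := j
    · simp [parent]
    · rw [parent_succ, ne_eq, Option.some_inj]
      simp
      omega

theorem edge_injective : Function.Injective (edge : (Σ i, Fin (y i)) → _) := by
  intro p q h
  rcases Sym2.eq_iff.1 h with h | h
  · exact Option.some_inj.1 h.1
  · exact absurd h.2.symm (parent_parent_ne h.1)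

theorem range_edge : Set.range (edge : (Σ i, Fin (y i)) → _) = (spider d y).edgeSet := by
  ext e
  induction e with
  | _ a b =>
    rw [SimpleGraph.mem_edgeSet, adj_iff]
    constructor
    · rintro ⟨p, hp⟩
      rcases Sym2.eq_iff.1 hp with h | h
      · exact ⟨p, Or.inl ⟨h.1.symm, h.2.symm⟩⟩
      · exact ⟨p, Or.inr ⟨h.1.symm, h.2.symm⟩⟩
    · rintro ⟨p, ⟨rfl, rfl⟩ | ⟨rfl, rfl⟩⟩
      · exact ⟨p, rfl⟩
      · exact ⟨p, Sym2.eq_swap⟩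

theorem ncard_edgeSet : (spider d y).edgeSet.ncard = ∑ i, y i := by
  rw [← range_edge, Set.ncard_range_of_injective edge_injective]
  simp

theorem neighborSet_none (hy : ∀ i, 0 < y i) :
    (spider d y).neighborSet none = Set.range fun i => some ⟨i, ⟨0, hy i⟩⟩ := by
  ext a
  simp only [SimpleGraph.mem_neighborSet, adj_iff, Set.mem_range]
  constructor
  · rintro ⟨⟨i, ⟨_ | j, hj⟩⟩, ⟨h, -⟩ | ⟨rfl, h⟩⟩
    · simp at h
    · exact ⟨i, rfl⟩
    · simp at h
    · simp [parent_succ] at h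
  · rintro ⟨i, rfl⟩
    exact ⟨_, Or.inr ⟨rfl, (parent_zero _).symm⟩⟩

theorem neighborSet_some {i : Fin d} {j : ℕ} (h : j + 1 < y i) :
    (spider d y).neighborSet (some ⟨i, ⟨j, by omega⟩⟩) =
      {parent ⟨i, ⟨j, by omega⟩⟩, some ⟨i, ⟨j + 1, h⟩⟩} := by
  ext a
  simp only [SimpleGraph.mem_neighborSet, adj_iff, Set.mem_insert_iff, Set.mem_singleton_iff]
  constructor
  · rintro ⟨p, ⟨hp, rfl⟩ | ⟨rfl, hp⟩⟩
    · rw [Option.some_inj] at hp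
      subst hp
      exact Or.inl rfl
    · obtain ⟨i', ⟨_ | j', hj⟩⟩ := p
      · simp [parent] at hp
      · rw [parent_succ, Option.some_inj] at hp
        cases hp
        exact Or.inr rfl
  · rintro (rfl | rfl)
    · exact ⟨_, Or.inl ⟨rfl, rfl⟩⟩
    · exact ⟨_, Or.inr ⟨rfl, (parent_succ h).symm⟩⟩

theorem neighborSet_leaf {i : Fin d} {j : ℕ} (h : j < y i) (h' : j + 1 = y i) :
    (spider d y).neighborSet (some ⟨i, ⟨j, h⟩⟩) = {parent ⟨i, ⟨j, h⟩⟩} := by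
  ext a
  simp only [SimpleGraph.mem_neighborSet, adj_iff, Set.mem_singleton_iff]
  constructor
  · rintro ⟨p, ⟨hp, rfl⟩ | ⟨rfl, hp⟩⟩
    · rw [Option.some_inj] at hp
      subst hp
      rfl
    · obtain ⟨i', ⟨_ | j', hj⟩⟩ := p
      · simp [parent] at hp
      · rw [parent_succ, Option.some_inj] at hp
        cases hp
        omega
  · rintro rfl
    exact ⟨_, Or.inl ⟨rfl, rfl⟩⟩

variable (f : Sym2 (Option (Σ i, Fin (y i))) → ℕ)

theorem vertexSum_none (hy : ∀ i, 0 < y i) :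
    vertexSum (spider d y) f none = ∑ i, f (edge ⟨i, ⟨0, hy i⟩⟩) := by
  rw [vertexSum, neighborSet_none hy, finsum_mem_range, finsum_eq_sum_of_fintype]
  · refine Finset.sum_congr rfl fun i _ => ?_
    rw [edge, parent_zero, Sym2.eq_swap]
  · intro i j h
    simpa using congrArg (Option.map Sigma.fst) h

theorem vertexSum_some {i : Fin d} {j : ℕ} (h : j + 1 < y i) :
    vertexSum (spider d y) f (some ⟨i, ⟨j, by omega⟩⟩) =
      f (edge ⟨i, ⟨j, by omega⟩⟩) + f (edge ⟨i, ⟨j + 1, h⟩⟩) := by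
  rw [vertexSum, neighborSet_some h, finsum_mem_pair, edge, edge, parent_succ h, Sym2.eq_swap]
  · congr 2
    exact Sym2.eq_swap
  · exact (parent_parent_ne (parent_succ h).symm).symm

theorem vertexSum_leaf {i : Fin d} {j : ℕ} (h : j < y i) (h' : j + 1 = y i) :
    vertexSum (spider d y) f (some ⟨i, ⟨j, h⟩⟩) = f (edge ⟨i, ⟨j, h⟩⟩) := by
  rw [vertexSum, neighborSet_leaf h h', finsum_mem_singleton, edge]

variable {f}

theorem lt_vertexSum_parent (hd : 2 ≤ d) (hy : ∀ i, 0 < y i) (hf : ∀ p, 0 < f (edge p))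
    (p : Σ i, Fin (y i)) : f (edge p) < vertexSum (spider d y) f (parent p) := by
  obtain ⟨i, ⟨_ | j, hj⟩⟩ := p
  · have : Nontrivial (Fin d) := Fin.nontrivial_iff_two_le.2 hd
    obtain ⟨k, hk⟩ := exists_ne i
    rw [parent_zero, vertexSum_none f hy]
    exact Finset.single_lt_sum (f := fun i => f (edge ⟨i, ⟨0, hy i⟩⟩)) hk (Finset.mem_univ i)
      (Finset.mem_univ k) (hf _) fun _ _ _ => Nat.zero_le _
  · rw [parent_succ, vertexSum_some f hj]
    have := hf ⟨i, ⟨j, by omega⟩⟩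
    omega

theorem succ_le_colorCount (hd : 2 ≤ d) (hy : ∀ i, 0 < y i)
    (hf : Set.BijOn f (spider d y).edgeSet (Set.Icc 1 (spider d y).edgeSet.ncard)) :
    d + 1 ≤ colorCount (spider d y) f := by
  have hmem : ∀ p, edge p ∈ (spider d y).edgeSet := fun p => range_edge ▸ ⟨p, rfl⟩
  have hIcc : ∀ p, f (edge p) ∈ Set.Icc 1 (spider d y).edgeSet.ncard := fun p => hf.1 (hmem p)
  have hq : 1 ≤ (spider d y).edgeSet.ncard := (hIcc ⟨⟨0, by omega⟩, ⟨0, hy _⟩⟩).1.trans (hIcc _).2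
  obtain ⟨e, he, hfe⟩ := hf.2.2 ⟨hq, le_rfl⟩
  obtain ⟨p, rfl⟩ := range_edge.symm ▸ he
  let last : Fin d → Σ i, Fin (y i) := fun i => ⟨i, ⟨y i - 1, Nat.sub_lt (hy i) one_pos⟩⟩
  let g : Option (Fin d) → Option (Σ i, Fin (y i)) := fun o => o.elim (parent p) (some ∘ last)
  have hlast : ∀ i, vertexSum (spider d y) f (g (some i)) = f (edge (last i)) := fun i =>
    vertexSum_leaf f _ (Nat.sub_add_cancel (hy i))
  have hlt : ∀ i, vertexSum (spider d y) f (g (some i)) < vertexSum (spider d y) f (g none) := by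
    intro i
    rw [hlast]
    exact ((hIcc _).2.trans_eq hfe.symm).trans_lt
      (lt_vertexSum_parent hd hy (fun p => (hIcc p).1) p)
  have hinj : Function.Injective (vertexSum (spider d y) f ∘ g) := by
    rintro (_ | i) (_ | j) h
    · rfl
    · exact absurd h (hlt j).ne'
    · exact absurd h (hlt i).ne
    · have h' : f (edge (last i)) = f (edge (last j)) := by rw [← hlast, ← hlast]; exact h
      exact congrArg some (congrArg Sigma.fst (edge_injective (hf.2.1 (hmem _) (hmem _) h')))
  have hcard := Set.ncard_range_of_injective hinj
  rw [Nat.card_eq_fintype_card, Fintype.card_option, Fintype.card_fin] at hcard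
  rw [← hcard]
  exact Set.ncard_le_ncard (Set.range_comp_subset_range _ _) (Set.finite_range _)

/-- `u i k` and `v i k` label the edges of a spider with legs of lengths `2 * ℓ i`: along leg `i`,
from the leaf to the core, the labels are `u i 0, v i 0, u i 1, v i 1, …`. They form a local
antimagic labeling whose vertex sums lie in `S`. -/
structure IsPairLabeling (ℓ : Fin d → ℕ) (u v : Fin d → ℕ → ℕ) (S : Finset ℕ) : Prop where
  u_mem : ∀ i k, k < ℓ i → u i k ∈ Set.Icc 1 (2 * ∑ i, ℓ i)
  v_mem : ∀ i k, k < ℓ i → v i k ∈ Set.Icc 1 (2 * ∑ i, ℓ i)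
  u_inj : ∀ i j k l, k < ℓ i → l < ℓ j → u i k = u j l → i = j ∧ k = l
  v_inj : ∀ i j k l, k < ℓ i → l < ℓ j → v i k = v j l → i = j ∧ k = l
  u_ne_v : ∀ i j k l, k < ℓ i → l < ℓ j → u i k ≠ v j l
  leaf : ∀ i, u i 0 ∈ S
  u_add_v : ∀ i k, k < ℓ i → u i k + v i k ∈ S
  v_add_u : ∀ i k, k + 1 < ℓ i → v i k + u i (k + 1) ∈ S
  core : ∑ i, v i (ℓ i - 1) ∈ S
  core_ne : ∀ i, ∑ i, v i (ℓ i - 1) ≠ u i (ℓ i - 1) + v i (ℓ i - 1)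

/-- The label of the edge joining a vertex to its parent. -/
def pairLabel (ℓ : Fin d → ℕ) (u v : Fin d → ℕ → ℕ) (p : Σ i, Fin (2 * ℓ i)) : ℕ :=
  if (p.2 : ℕ) % 2 = 0 then v p.1 (ℓ p.1 - 1 - p.2 / 2) else u p.1 (ℓ p.1 - 1 - p.2 / 2)

variable {ℓ : Fin d → ℕ} {u v : Fin d → ℕ → ℕ} {S : Finset ℕ}

theorem pairLabel_even {i : Fin d} {j k : ℕ} (hj : j < 2 * ℓ i) (h : 2 * (k + 1) + j = 2 * ℓ i) :
    pairLabel ℓ u v ⟨i, ⟨j, hj⟩⟩ = v i k := by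
  rw [pairLabel, if_pos (by simp only; omega)]
  congr 1
  simp only
  omega

theorem pairLabel_odd {i : Fin d} {j k : ℕ} (hj : j < 2 * ℓ i) (h : 2 * k + 1 + j = 2 * ℓ i) :
    pairLabel ℓ u v ⟨i, ⟨j, hj⟩⟩ = u i k := by
  rw [pairLabel, if_neg (by simp only; omega)]
  congr 1
  simp only
  omega

theorem exists_pairLabel (p : Σ i, Fin (2 * ℓ i)) : ∃ k < ℓ p.1,
    2 * (k + 1) + p.2 = 2 * ℓ p.1 ∧ pairLabel ℓ u v p = v p.1 k ∨
      2 * k + 1 + p.2 = 2 * ℓ p.1 ∧ pairLabel ℓ u v p = u p.1 k := by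
  obtain ⟨i, ⟨j, hj⟩⟩ := p
  refine ⟨ℓ i - 1 - j / 2, by simp only; omega, ?_⟩
  rcases Nat.mod_two_eq_zero_or_one j with h | h
  · exact Or.inl ⟨by simp only; omega, pairLabel_even hj (by omega)⟩
  · exact Or.inr ⟨by simp only; omega, pairLabel_odd hj (by omega)⟩

namespace IsPairLabeling

theorem pairLabel_mem (H : IsPairLabeling ℓ u v S) (p : Σ i, Fin (2 * ℓ i)) :
    pairLabel ℓ u v p ∈ Set.Icc 1 (2 * ∑ i, ℓ i) := by
  obtain ⟨k, hk, ⟨-, h⟩ | ⟨-, h⟩⟩ := exists_pairLabel (u := u) (v := v) p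
  · exact h ▸ H.v_mem _ _ hk
  · exact h ▸ H.u_mem _ _ hk

theorem pairLabel_injective (H : IsPairLabeling ℓ u v S) :
    Function.Injective (pairLabel ℓ u v) := by
  intro p q h
  obtain ⟨k, hk, ⟨hp, h₁⟩ | ⟨hp, h₁⟩⟩ := exists_pairLabel (u := u) (v := v) p <;>
  obtain ⟨l, hl, ⟨hq, h₂⟩ | ⟨hq, h₂⟩⟩ := exists_pairLabel (u := u) (v := v) q <;>
  rw [h₁, h₂] at h <;> obtain ⟨i, a⟩ := p <;> obtain ⟨j, b⟩ := q
  · obtain ⟨rfl, rfl⟩ : i = j ∧ k = l := H.v_inj _ _ _ _ hk hl h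
    obtain rfl : a = b := Fin.ext (by simp only at hp hq; omega)
    rfl
  · exact absurd h.symm (H.u_ne_v _ _ _ _ hl hk)
  · exact absurd h (H.u_ne_v _ _ _ _ hk hl)
  · obtain ⟨rfl, rfl⟩ : i = j ∧ k = l := H.u_inj _ _ _ _ hk hl h
    obtain rfl : a = b := Fin.ext (by simp only at hp hq; omega)
    rfl

theorem exists_isLocalAntimagic (H : IsPairLabeling ℓ u v S) (hℓ : ∀ i, 0 < ℓ i) :
    ∃ f, IsLocalAntimagic (spider d fun i => 2 * ℓ i) f ∧
      colorCount (spider d fun i => 2 * ℓ i) f ≤ S.card := by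
  let f : Sym2 (Option (Σ i, Fin (2 * ℓ i))) → ℕ := Function.extend edge (pairLabel ℓ u v) 0
  have hf : ∀ p, f (edge p) = pairLabel ℓ u v p := edge_injective.extend_apply _ _
  have hy : ∀ i, 0 < 2 * ℓ i := fun i => Nat.mul_pos two_pos (hℓ i)
  have hnone : vertexSum (spider d fun i => 2 * ℓ i) f none = ∑ i, v i (ℓ i - 1) := by
    rw [vertexSum_none f hy]
    refine Finset.sum_congr rfl fun i _ => ?_
    have := hℓ i
    rw [hf, pairLabel_even (k := ℓ i - 1) _ (by omega)]
  refine ⟨f, ⟨⟨?_, ?_, ?_⟩, ?_⟩, ?_⟩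
  · rw [ncard_edgeSet, ← Finset.mul_sum, ← range_edge]
    rintro _ ⟨p, rfl⟩
    exact hf p ▸ H.pairLabel_mem p
  · rw [← range_edge]
    rintro _ ⟨p, rfl⟩ _ ⟨q, rfl⟩ h
    rw [hf, hf] at h
    rw [H.pairLabel_injective h]
  · have himage : f '' (spider d fun i => 2 * ℓ i).edgeSet = Set.range (pairLabel ℓ u v) := by
      rw [← range_edge, ← Set.range_comp]
      exact congrArg Set.range (funext hf)
    rw [Set.SurjOn, himage]
    refine (Set.eq_of_subset_of_ncard_le ?_ ?_ (Set.finite_Icc _ _)).ge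
    · rw [ncard_edgeSet, ← Finset.mul_sum]
      rintro _ ⟨p, rfl⟩
      exact H.pairLabel_mem p
    · rw [Set.ncard_range_of_injective H.pairLabel_injective, ← range_edge,
        Set.ncard_range_of_injective edge_injective, Set.ncard_Icc_nat]
      simp
  · have hne : ∀ p, vertexSum (spider d fun i => 2 * ℓ i) f (some p) ≠
        vertexSum (spider d fun i => 2 * ℓ i) f (parent p) := by
      rintro ⟨i, ⟨_ | j, hj⟩⟩
      · rw [parent_zero, hnone, vertexSum_some f (j := 0) (by have := hℓ i; omega),
          hf, hf, pairLabel_even (k := ℓ i - 1) _ (by omega),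
          pairLabel_odd (k := ℓ i - 1) _ (by omega), add_comm]
        exact (H.core_ne i).symm
      · rw [parent_succ, vertexSum_some f hj]
        rcases lt_or_ge (j + 2) (2 * ℓ i) with hj' | hj'
        · rw [vertexSum_some f hj', hf, hf, hf, add_comm]
          intro h
          have := H.pairLabel_injective (Nat.add_right_cancel h)
          simp only [Sigma.mk.injEq, heq_eq_eq, Fin.mk.injEq, true_and] at this
          omega
        · rw [vertexSum_leaf f hj (by omega), hf, hf]
          have := (H.pairLabel_mem ⟨i, ⟨j, by omega⟩⟩).1
          omega
    intro a b hab
    obtain ⟨p, ⟨rfl, rfl⟩ | ⟨rfl, rfl⟩⟩ := adj_iff.1 hab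
    · exact hne p
    · exact (hne p).symm
  · rw [colorCount, ← Set.ncard_coe_finset]
    refine Set.ncard_le_ncard ?_ (Finset.finite_toSet S)
    rintro _ ⟨_ | ⟨i, ⟨j, hj⟩⟩, rfl⟩
    · exact hnone ▸ H.core
    · rcases lt_or_ge (j + 1) (2 * ℓ i) with hj' | hj'
      · rw [vertexSum_some f hj', hf, hf]
        obtain ⟨k, rfl | rfl⟩ := Nat.even_or_odd' j
        · rw [pairLabel_even (k := ℓ i - 1 - k) _ (by omega),
            pairLabel_odd (k := ℓ i - 1 - k) _ (by omega), add_comm]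
          exact H.u_add_v i _ (by omega)
        · rw [pairLabel_odd (k := ℓ i - 2 - k + 1) _ (by omega),
            pairLabel_even (k := ℓ i - 2 - k) _ (by omega), add_comm]
          exact H.v_add_u i _ (by omega)
      · rw [vertexSum_leaf f hj (by omega), hf, pairLabel_odd (k := 0) _ (by omega)]
        exact H.leaf i

theorem chiLA_eq (H : IsPairLabeling ℓ u v S) (hℓ : ∀ i, 0 < ℓ i) (hd : 2 ≤ d)
    (hS : S.card ≤ d + 1) : chiLA (spider d fun i => 2 * ℓ i) = d + 1 := by
  have hy : ∀ i, 0 < 2 * ℓ i := fun i => Nat.mul_pos two_pos (hℓ i)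
  obtain ⟨f, hf, hcard⟩ := H.exists_isLocalAntimagic hℓ
  have hle : chiLA (spider d fun i => 2 * ℓ i) ≤ _ := Nat.sInf_le ⟨f, hf, rfl⟩
  refine le_antisymm (hle.trans (hcard.trans hS)) ?_
  refine le_csInf ⟨_, f, hf, rfl⟩ ?_
  rintro _ ⟨g, hg, rfl⟩
  exact succ_le_colorCount hd hy hg.1

end IsPairLabeling

theorem isPairLabeling_of_eq_left {n h : ℕ} (hn : 1 ≤ n) (hnh : n ≤ h) :
    IsPairLabeling ![n, n, h]
      ![fun k => 4 * n + 2 * h - k, fun k => 3 * n + h - k, fun k => 3 * n + 2 * h - k]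
      ![fun k => k + 1, fun k => n + h + k + 1, fun k => n + k + 1]
      {4 * n + 2 * h + 1, 4 * n + 2 * h, 3 * n + 2 * h, 3 * n + h} := by
  constructor
  · intro i k
    fin_cases i <;> simp [Fin.sum_univ_three] <;> grind
  · intro i k
    fin_cases i <;> simp [Fin.sum_univ_three] <;> grind
  · intro i j k l
    fin_cases i <;> fin_cases j <;> simp <;> grind
  · intro i j k l
    fin_cases i <;> fin_cases j <;> simp <;> grind
  · intro i j k l
    fin_cases i <;> fin_cases j <;> simp <;> grind
  · intro i
    fin_cases i <;> simp
  · intro i k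
    fin_cases i <;> simp <;> grind
  · intro i k
    fin_cases i <;> simp <;> grind
  · simp [Fin.sum_univ_three]
    grind
  · intro i
    fin_cases i <;> simp [Fin.sum_univ_three] <;> grind

theorem isPairLabeling_of_eq_right {n m : ℕ} (hn : 1 ≤ n) (hnm : n ≤ m) :
    IsPairLabeling ![n, m, m]
      ![fun k => 3 * m + 2 * n - k, fun k => 4 * m + 2 * n - k, fun k => 3 * m + n - k]
      ![fun k => m + k + 1, fun k => k + 1, fun k => m + n + k + 1]
      {4 * m + 2 * n + 1, 4 * m + 2 * n, 3 * m + 2 * n, 3 * m + n} := by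
  constructor
  · intro i k
    fin_cases i <;> simp [Fin.sum_univ_three] <;> grind
  · intro i k
    fin_cases i <;> simp [Fin.sum_univ_three] <;> grind
  · intro i j k l
    fin_cases i <;> fin_cases j <;> simp <;> grind
  · intro i j k l
    fin_cases i <;> fin_cases j <;> simp <;> grind
  · intro i j k l
    fin_cases i <;> fin_cases j <;> simp <;> grind
  · intro i
    fin_cases i <;> simp
  · intro i k
    fin_cases i <;> simp <;> grind
  · intro i k
    fin_cases i <;> simp <;> grind
  · simp [Fin.sum_univ_three]
    grind
  · intro i
    fin_cases i <;> simp [Fin.sum_univ_three] <;> grind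

set_option maxHeartbeats 1000000 in
theorem isPairLabeling_of_add_two_le {n : ℕ} (hn : 1 ≤ n) (j r : ℕ) :
    IsPairLabeling ![n, n + 2 + j, n + 3 + j + r]
      ![fun k => 6 * n + 9 + 4 * j + 2 * r - k,
        fun k => if k ≤ j + 1 then 5 * n + 9 + 4 * j + 2 * r - 2 * k
          else 5 * n + 8 + 3 * j + 2 * r - k,
        fun k => if k = 0 then 6 * n + 10 + 4 * j + 2 * r
          else if n + j + 2 < k ∨ k ≤ j + 1 then 5 * n + 10 + 4 * j + 2 * r - 2 * k
          else 4 * n + 8 + 3 * j + 2 * r - k]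
      ![fun k => 2 + k,
        fun k => if k ≤ j + 1 then n + 2 + 2 * k else n + 3 + j + k,
        fun k => if k = 0 then 1
          else if n + j + 2 < k ∨ k ≤ j + 1 then n + 1 + 2 * k
          else 2 * n + 3 + j + k]
      {6 * n + 11 + 4 * j + 2 * r, 6 * n + 10 + 4 * j + 2 * r, 6 * n + 9 + 4 * j + 2 * r,
        5 * n + 9 + 4 * j + 2 * r} := by
  constructor
  · intro i k
    fin_cases i <;> simp [Fin.sum_univ_three] <;> grind
  · intro i k
    fin_cases i <;> simp [Fin.sum_univ_three] <;> grind
  · intro i j k l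
    fin_cases i <;> fin_cases j <;> simp <;> intros <;> first | grind | (split_ifs at * <;> omega)
  · intro i j k l
    fin_cases i <;> fin_cases j <;> simp <;> grind
  · intro i j k l
    fin_cases i <;> fin_cases j <;> simp <;> grind
  · intro i
    fin_cases i <;> simp
  · intro i k
    fin_cases i <;> simp <;> grind
  · intro i k
    fin_cases i <;> simp <;> grind
  · simp [Fin.sum_univ_three]
    grind
  · intro i
    fin_cases i <;> simp [Fin.sum_univ_three] <;> grind

theorem isPairLabeling_one_two {h : ℕ} (hh : 1 ≤ h) :
    IsPairLabeling ![1, 2, h]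
      ![fun _ => 2 * h + 6, fun k => 2 * h + 5 - 2 * k, fun k => 2 * h + 4 - 2 * k]
      ![fun _ => 1, fun k => 2 * k + 2, fun k => 2 * k + 3]
      {2 * h + 7, 2 * h + 6, 2 * h + 5, 2 * h + 4} := by
  constructor
  · intro i k
    fin_cases i <;> simp [Fin.sum_univ_three] <;> grind
  · intro i k
    fin_cases i <;> simp [Fin.sum_univ_three] <;> grind
  · intro i j k l
    fin_cases i <;> fin_cases j <;> simp <;> grind
  · intro i j k l
    fin_cases i <;> fin_cases j <;> simp <;> grind
  · intro i j k l
    fin_cases i <;> fin_cases j <;> simp <;> grind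
  · intro i
    fin_cases i <;> simp
  · intro i k
    fin_cases i <;> simp <;> grind
  · intro i k
    fin_cases i <;> simp <;> grind
  · simp [Fin.sum_univ_three]
    grind
  · intro i
    fin_cases i <;> simp [Fin.sum_univ_three] <;> grind

set_option maxHeartbeats 1000000 in
theorem isPairLabeling_even {n : ℕ} (hn : 1 ≤ n) (t : ℕ) :
    IsPairLabeling ![n, n + 1, n + 2 + 2 * t]
      ![fun k => 6 * n + 6 + 4 * t - 3 * k,
        fun k => 3 * n + 4 + 4 * t + 3 * k,
        fun k => if k < n + 1 then 6 * n + 5 + 4 * t - 3 * k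
          else if k < n + 1 + 2 * t then
            5 * n + 4 + 4 * t - 2 * k + (k - (n + 1)) % 2
          else 3 * n + 2]
      ![fun k => 3 * k + 2,
        fun k => 3 * (n - k) + 1,
        fun k => if k < n + 1 then 3 * k + 3
          else if k < n + 1 + 2 * t then n + 2 + 2 * k + (k - (n + 1)) % 2
          else 3 * n + 6 + 4 * t]
      {6 * n + 8 + 4 * t, 6 * n + 6 + 4 * t, 6 * n + 5 + 4 * t, 3 * n + 4 + 4 * t} := by
  constructor
  · intro i k
    fin_cases i <;> simp [Fin.sum_univ_three] <;> grind
  · intro i k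
    fin_cases i <;> simp [Fin.sum_univ_three] <;> grind
  · intro i j k l
    fin_cases i <;> fin_cases j <;> simp <;> grind
  · intro i j k l
    fin_cases i <;> fin_cases j <;> simp <;> intros <;> first | grind | (split_ifs at * <;> omega)
  · intro i j k l
    fin_cases i <;> fin_cases j <;> simp <;> grind
  · intro i
    fin_cases i <;> simp
  · intro i k
    fin_cases i <;> simp <;> grind
  · intro i k
    fin_cases i <;> simp <;> grind
  · simp [Fin.sum_univ_three]
    grind
  · intro i
    fin_cases i <;> simp [Fin.sum_univ_three] <;> grind

set_option maxHeartbeats 1000000 in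
theorem isPairLabeling_odd {n t : ℕ} (hn : 2 ≤ n) (ht : 1 ≤ t) :
    IsPairLabeling ![n, n + 1, n + 1 + 2 * t]
      ![fun k => 6 * n + 4 + 4 * t - 3 * k,
        fun k => if k = 0 then 3 * n + 1 + 4 * t else if k = 1 then 3 * n + 4 + 4 * t
          else 3 * n + 4 * t + 3 * k,
        fun k => if k = 0 then 6 * n + 3 + 4 * t else if k ≤ n then 6 * n + 5 + 4 * t - 3 * k
          else if k = n + 1 then 3 * n + 3 + 4 * t
          else 5 * n + 3 + 4 * t - 2 * k + (k - (n + 1)) % 2]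
      ![fun k => 3 * k + 2,
        fun k => if k = 0 then 3 * n + 2 else 3 * (n + 1 - k),
        fun k => if k ≤ n then 3 * k + 1 else n + 1 + 2 * k + (k - (n + 1)) % 2]
      {6 * n + 6 + 4 * t, 6 * n + 4 + 4 * t, 6 * n + 3 + 4 * t, 3 * n + 1 + 4 * t} := by
  constructor
  · intro i k
    fin_cases i <;> simp [Fin.sum_univ_three] <;> grind
  · intro i k
    fin_cases i <;> simp [Fin.sum_univ_three] <;> grind
  · intro i j k l
    fin_cases i <;> fin_cases j <;> simp <;> grind
  · intro i j k l
    fin_cases i <;> fin_cases j <;> simp <;> intros <;> first | grind | (split_ifs at * <;> omega)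
  · intro i j k l
    fin_cases i <;> fin_cases j <;> simp <;> grind
  · intro i
    fin_cases i <;> simp
  · intro i k
    fin_cases i <;> simp <;> grind
  · intro i k
    fin_cases i <;> simp <;> grind
  · simp [Fin.sum_univ_three]
    grind
  · intro i
    fin_cases i <;> simp [Fin.sum_univ_three] <;> grind

end Spider

theorem stmt16 (n m h : ℕ) (hn : 1 ≤ n) (hnm : n ≤ m) (hmh : m ≤ h) :
    chiLA (spider 3 ![2 * n, 2 * m, 2 * h]) = 4 := by
  have hy : ![2 * n, 2 * m, 2 * h] = fun i => 2 * ![n, m, h] i := by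
    ext i
    fin_cases i <;> rfl
  have hℓ : ∀ i, 0 < ![n, m, h] i := by
    intro i
    fin_cases i <;> simp <;> omega
  suffices ∃ u v a b c e, Spider.IsPairLabeling ![n, m, h] u v {a, b, c, e} by
    obtain ⟨u, v, a, b, c, e, H⟩ := this
    rw [hy]
    exact H.chiLA_eq hℓ (by norm_num) Finset.card_le_four
  rcases hnm.eq_or_lt with rfl | hnm'
  · exact ⟨_, _, _, _, _, _, Spider.isPairLabeling_of_eq_left hn hmh⟩
  rcases hmh.eq_or_lt with rfl | hmh'
  · exact ⟨_, _, _, _, _, _, Spider.isPairLabeling_of_eq_right hn hnm⟩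
  rcases (Nat.succ_le_of_lt hnm').eq_or_lt with rfl | hnm''
  · obtain ⟨t, ht⟩ := Nat.even_or_odd' (h - n)
    rcases ht with ht | ht
    · obtain ⟨t, rfl⟩ : ∃ s, t = s + 1 := ⟨t - 1, by omega⟩
      obtain rfl : h = n + 2 + 2 * t := by omega
      exact ⟨_, _, _, _, _, _, Spider.isPairLabeling_even hn t⟩
    · obtain rfl : h = n + 1 + 2 * t := by omega
      rcases hn.eq_or_lt with rfl | hn'
      · exact ⟨_, _, _, _, _, _, Spider.isPairLabeling_one_two (by omega)⟩
      · exact ⟨_, _, _, _, _, _, Spider.isPairLabeling_odd hn' (by omega)⟩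
  · obtain ⟨j, rfl⟩ := Nat.exists_eq_add_of_le hnm''
    obtain ⟨r, rfl⟩ := Nat.exists_eq_add_of_le hmh'
    have H := Spider.isPairLabeling_of_add_two_le hn j r
    rw [show n + 3 + j + r = n + 2 + j + 1 + r by ring] at H
    exact ⟨_, _, _, _, _, _, H⟩
end

section
/- For all integers m > n ≥ 0, the spider Sp(2n+1, 2m+1, 4(m−n)−1) has local antimagic chromatic number 4. -/
open SimpleGraph

section Spider

variable {d : ℕ} {y : Fin d → ℕ}

/-- The neighbour of a non-core vertex on the side of the core. -/
def spiderParent : (Σ i : Fin d, Fin (y i)) → Option (Σ i : Fin d, Fin (y i))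
  | ⟨_, ⟨0, _⟩⟩ => none
  | ⟨i, ⟨j + 1, h⟩⟩ => some ⟨i, ⟨j, by omega⟩⟩

/-- The edge joining a non-core vertex to its parent. -/
def spiderEdge (v : Σ i : Fin d, Fin (y i)) : Sym2 (Option (Σ i : Fin d, Fin (y i))) :=
  s(some v, spiderParent v)

theorem spider_adj_none_some (i : Fin d) (j : Fin (y i)) :
    (spider d y).Adj none (some ⟨i, j⟩) ↔ (j : ℕ) = 0 := by
  simp only [spider, SimpleGraph.fromRel_adj]
  constructor
  · rintro ⟨-, ⟨i', j', ⟨-, h, h0⟩ | ⟨k, h, -⟩⟩ | ⟨i', j', ⟨h, -⟩ | ⟨k, -, h, -⟩⟩⟩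
    · simp only [Option.some.injEq] at h
      cases h
      exact h0
    all_goals simp at h
  · intro h
    exact ⟨by simp, Or.inl ⟨i, j, Or.inl ⟨trivial, rfl, h⟩⟩⟩

theorem spider_adj_some_some (i i' : Fin d) (j : Fin (y i)) (k : Fin (y i')) :
    (spider d y).Adj (some ⟨i, j⟩) (some ⟨i', k⟩) ↔
      i = i' ∧ ((j : ℕ) + 1 = k ∨ (k : ℕ) + 1 = j) := by
  simp only [spider, SimpleGraph.fromRel_adj]
  constructor
  · rintro ⟨-, ⟨a, b, ⟨h, -⟩ | ⟨c, h, h', hbc⟩⟩ | ⟨a, b, ⟨h, -⟩ | ⟨c, h, h', hbc⟩⟩⟩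
    · simp at h
    · simp only [Option.some.injEq] at h h'
      cases h
      cases h'
      exact ⟨rfl, Or.inl hbc⟩
    · simp at h
    · simp only [Option.some.injEq] at h h'
      cases h
      cases h'
      exact ⟨rfl, Or.inr hbc⟩
  · rintro ⟨rfl, h⟩
    refine ⟨fun he => ?_, ?_⟩
    · simp only [Option.some.injEq] at he
      cases he
      omega
    · rcases h with h | h
      · exact Or.inl ⟨i, j, Or.inr ⟨k, rfl, rfl, h⟩⟩
      · exact Or.inr ⟨i, k, Or.inr ⟨j, rfl, rfl, h⟩⟩

theorem spider_adj_parent (v : Σ i : Fin d, Fin (y i)) :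
    (spider d y).Adj (some v) (spiderParent v) := by
  obtain ⟨i, ⟨_ | j, h⟩⟩ := v
  · exact ((spider_adj_none_some i _).2 rfl).symm
  · exact (spider_adj_some_some i i _ _).2 ⟨rfl, Or.inr rfl⟩

theorem spider_adj_iff (u v : Option (Σ i : Fin d, Fin (y i))) :
    (spider d y).Adj u v ↔
      (∃ w, u = some w ∧ v = spiderParent w) ∨ ∃ w, v = some w ∧ u = spiderParent w := by
  constructor
  · intro h
    rcases u with _ | ⟨i, ⟨j, hj⟩⟩ <;> rcases v with _ | ⟨i', ⟨k, hk⟩⟩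
    · exact absurd h (SimpleGraph.irrefl _)
    · obtain rfl : k = 0 := (spider_adj_none_some _ _).1 h
      exact Or.inr ⟨_, rfl, rfl⟩
    · obtain rfl : j = 0 := (spider_adj_none_some _ _).1 h.symm
      exact Or.inl ⟨_, rfl, rfl⟩
    · obtain ⟨rfl, h⟩ := (spider_adj_some_some _ _ _ _).1 h
      rcases h with h | h
      · obtain rfl : j + 1 = k := h
        exact Or.inr ⟨_, rfl, rfl⟩
      · obtain rfl : k + 1 = j := h
        exact Or.inl ⟨_, rfl, rfl⟩
  · rintro (⟨w, rfl, rfl⟩ | ⟨w, rfl, rfl⟩)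
    · exact spider_adj_parent w
    · exact (spider_adj_parent w).symm

theorem range_spiderEdge : Set.range (spiderEdge (y := y)) = (spider d y).edgeSet := by
  ext e
  induction e using Sym2.ind with
  | _ u v =>
    rw [SimpleGraph.mem_edgeSet, spider_adj_iff]
    simp only [Set.mem_range, spiderEdge, Sym2.eq_iff]
    constructor
    · rintro ⟨w, ⟨rfl, rfl⟩ | ⟨rfl, rfl⟩⟩
      · exact Or.inl ⟨w, rfl, rfl⟩
      · exact Or.inr ⟨w, rfl, rfl⟩
    · rintro (⟨w, rfl, rfl⟩ | ⟨w, rfl, rfl⟩)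
      · exact ⟨w, Or.inl ⟨rfl, rfl⟩⟩
      · exact ⟨w, Or.inr ⟨rfl, rfl⟩⟩

theorem spiderEdge_injective : Function.Injective (spiderEdge (y := y)) := by
  intro v w h
  rcases Sym2.eq_iff.1 h with ⟨h, -⟩ | ⟨h, h'⟩
  · exact Option.some.inj h
  · exfalso
    obtain ⟨i, ⟨_ | j, hj⟩⟩ := v
    · simp [spiderParent] at h'
    obtain ⟨i', ⟨_ | k, hk⟩⟩ := w
    · simp [spiderParent] at h
    simp only [spiderParent, Option.some.injEq] at h h'
    cases h
    simp at h'
    omega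

theorem ncard_edgeSet_spider : (spider d y).edgeSet.ncard = ∑ i, y i := by
  rw [← range_spiderEdge, ← Set.image_univ, Set.ncard_image_of_injective _ spiderEdge_injective]
  simp [Set.ncard_univ]

theorem vertexSum_spider_core (hy : ∀ i, 0 < y i)
    (f : Sym2 (Option (Σ i : Fin d, Fin (y i))) → ℕ) :
    vertexSum (spider d y) f none = ∑ i, f (spiderEdge ⟨i, ⟨0, hy i⟩⟩) := by
  have hN : (spider d y).neighborSet none =
      Set.range fun i : Fin d => some (⟨i, ⟨0, hy i⟩⟩ : Σ i : Fin d, Fin (y i)) := by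
    ext v
    rcases v with _ | ⟨i, j, hj⟩
    · simp
    · simp only [SimpleGraph.mem_neighborSet, spider_adj_none_some, Set.mem_range]
      constructor
      · rintro rfl
        exact ⟨i, rfl⟩
      · rintro ⟨i', h⟩
        simp only [Option.some.injEq] at h
        cases h
        rfl
  have hinj : Function.Injective
      fun i : Fin d => some (⟨i, ⟨0, hy i⟩⟩ : Σ i : Fin d, Fin (y i)) := by
    intro a b h
    simp only [Option.some.injEq] at h
    exact congrArg Sigma.fst h
  rw [vertexSum, hN, finsum_mem_range hinj, finsum_eq_sum_of_fintype]
  exact Finset.sum_congr rfl fun i _ => congrArg f Sym2.eq_swap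

theorem vertexSum_spider_inner (f : Sym2 (Option (Σ i : Fin d, Fin (y i))) → ℕ) (i : Fin d)
    (j : ℕ) (h : j + 1 < y i) :
    vertexSum (spider d y) f (some ⟨i, ⟨j, by omega⟩⟩) =
      f (spiderEdge ⟨i, ⟨j, by omega⟩⟩) + f (spiderEdge ⟨i, ⟨j + 1, h⟩⟩) := by
  have hN : (spider d y).neighborSet (some ⟨i, ⟨j, by omega⟩⟩) =
      {spiderParent ⟨i, ⟨j, by omega⟩⟩, some ⟨i, ⟨j + 1, h⟩⟩} := by
    ext v
    simp only [SimpleGraph.mem_neighborSet, spider_adj_iff, Set.mem_insert_iff,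
      Set.mem_singleton_iff]
    constructor
    · rintro (⟨w, hw, rfl⟩ | ⟨⟨i', _ | k, hk⟩, rfl, hw⟩)
      · exact Or.inl (by rw [Option.some.inj hw])
      · simp [spiderParent] at hw
      · simp only [spiderParent, Option.some.injEq] at hw
        cases hw
        exact Or.inr rfl
    · rintro (rfl | rfl)
      · exact Or.inl ⟨_, rfl, rfl⟩
      · exact Or.inr ⟨_, rfl, rfl⟩
  have hne : spiderParent ⟨i, ⟨j, by omega⟩⟩ ≠ some (⟨i, ⟨j + 1, h⟩⟩ : Σ i : Fin d, Fin (y i)) := by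
    rcases j with _ | j
    · simp [spiderParent]
    · simp [spiderParent]
      omega
  rw [vertexSum, hN, finsum_mem_pair hne]
  exact congrArg (_ + ·) (congrArg f Sym2.eq_swap)

theorem vertexSum_spider_leaf (f : Sym2 (Option (Σ i : Fin d, Fin (y i))) → ℕ) (i : Fin d)
    (j : ℕ) (h : j + 1 = y i) :
    vertexSum (spider d y) f (some ⟨i, ⟨j, by omega⟩⟩) = f (spiderEdge ⟨i, ⟨j, by omega⟩⟩) := by
  have hN : (spider d y).neighborSet (some ⟨i, ⟨j, by omega⟩⟩) =
      {spiderParent ⟨i, ⟨j, by omega⟩⟩} := by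
    ext v
    simp only [SimpleGraph.mem_neighborSet, spider_adj_iff, Set.mem_singleton_iff]
    constructor
    · rintro (⟨w, hw, rfl⟩ | ⟨⟨i', _ | k, hk⟩, rfl, hw⟩)
      · rw [Option.some.inj hw]
      · simp [spiderParent] at hw
      · simp only [spiderParent, Option.some.injEq] at hw
        cases hw
        omega
    · rintro rfl
      exact Or.inl ⟨_, rfl, rfl⟩
  rw [vertexSum, hN, finsum_mem_singleton]
  rfl

theorem succ_le_colorCount_spider (hd : 2 ≤ d) (hy : ∀ i, 0 < y i)
    {f : Sym2 (Option (Σ i : Fin d, Fin (y i))) → ℕ} (hf : IsLocalAntimagic (spider d y) f) :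
    d + 1 ≤ colorCount (spider d y) f := by
  obtain ⟨⟨hmaps, hinj, hsurj⟩, -⟩ := hf
  have hmem (v : Σ i : Fin d, Fin (y i)) : spiderEdge v ∈ (spider d y).edgeSet :=
    range_spiderEdge ▸ Set.mem_range_self v
  have hpos (v : Σ i : Fin d, Fin (y i)) : 1 ≤ f (spiderEdge v) := (hmaps (hmem v)).1
  let i₀ : Fin d := ⟨0, by omega⟩
  obtain ⟨e, he, heq⟩ : (spider d y).edgeSet.ncard ∈ f '' (spider d y).edgeSet :=
    hsurj ⟨(hpos ⟨i₀, ⟨0, hy i₀⟩⟩).trans (hmaps (hmem _)).2, le_rfl⟩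
  rw [← range_spiderEdge] at he
  obtain ⟨w, rfl⟩ := he
  have hbig : (spider d y).edgeSet.ncard < vertexSum (spider d y) f (spiderParent w) := by
    rw [← heq]
    obtain ⟨i, ⟨_ | j, hj⟩⟩ := w
    · obtain ⟨i', hi'⟩ : ∃ i' : Fin d, i' ≠ i :=
        haveI : Nontrivial (Fin d) := Fin.nontrivial_iff_two_le.2 hd
        exists_ne i
      rw [show spiderParent ⟨i, ⟨0, hj⟩⟩ = none from rfl, vertexSum_spider_core hy]
      exact Finset.single_lt_sum (f := fun i => f (spiderEdge ⟨i, ⟨0, hy i⟩⟩)) hi'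
        (Finset.mem_univ i) (Finset.mem_univ i') (hpos _) fun _ _ _ => Nat.zero_le _
    · rw [show spiderParent ⟨i, ⟨j + 1, hj⟩⟩ = some ⟨i, ⟨j, by omega⟩⟩ from rfl,
        vertexSum_spider_inner f i j hj]
      have := hpos ⟨i, ⟨j, by omega⟩⟩
      omega
  let leaf (i : Fin d) : Σ i : Fin d, Fin (y i) := ⟨i, ⟨y i - 1, Nat.sub_lt (hy i) one_pos⟩⟩
  have hleaf (i : Fin d) :
      vertexSum (spider d y) f (some (leaf i)) = f (spiderEdge (leaf i)) :=
    vertexSum_spider_leaf f i _ (Nat.sub_add_cancel (hy i))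
  have hcol : Function.Injective fun o : Option (Fin d) =>
      vertexSum (spider d y) f (o.elim (spiderParent w) fun i => some (leaf i)) := by
    have hlt (i : Fin d) : vertexSum (spider d y) f (some (leaf i)) <
        vertexSum (spider d y) f (spiderParent w) :=
      (hleaf i).trans_le (hmaps (hmem _)).2 |>.trans_lt hbig
    rintro (_ | a) (_ | b) h
    · rfl
    · exact absurd h (hlt b).ne'
    · exact absurd h (hlt a).ne
    · simp only [Option.elim_some, hleaf] at h
      exact congrArg some (congrArg Sigma.fst (spiderEdge_injective (hinj (hmem _) (hmem _) h)))
  calc d + 1 = (Set.range fun o : Option (Fin d) => vertexSum (spider d y) f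
        (o.elim (spiderParent w) fun i => some (leaf i))).ncard := by
        rw [← Set.image_univ, Set.ncard_image_of_injective _ hcol]
        simp [Set.ncard_univ]
    _ ≤ _ := Set.ncard_le_ncard (by rintro _ ⟨o, rfl⟩; exact Set.mem_range_self _)
        (Set.finite_range _)

theorem exists_bijOn_edgeSet_spider (g : (i : Fin d) → ℕ → ℕ)
    (hg : ∀ i, ∀ j < y i, 1 ≤ g i j ∧ g i j ≤ ∑ i, y i)
    (hinj : ∀ i, ∀ j < y i, ∀ i', ∀ j' < y i', g i j = g i' j' → i = i' ∧ j = j') :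
    ∃ f : Sym2 (Option (Σ i : Fin d, Fin (y i))) → ℕ,
      Set.BijOn f (spider d y).edgeSet (Set.Icc 1 (spider d y).edgeSet.ncard) ∧
      ∀ i j (h : j < y i), f (spiderEdge ⟨i, ⟨j, h⟩⟩) = g i j := by
  have hinj' : Function.Injective fun v : Σ i : Fin d, Fin (y i) => g v.1 v.2 := by
    rintro ⟨i, j, hj⟩ ⟨i', j', hj'⟩ h
    obtain ⟨rfl, rfl⟩ := hinj i j hj i' j' hj' h
    rfl
  have himage : Finset.univ.image (fun v : Σ i : Fin d, Fin (y i) => g v.1 v.2) =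
      Finset.Icc 1 (∑ i, y i) := by
    refine Finset.eq_of_subset_of_card_le ?_ ?_
    · intro a ha
      obtain ⟨v, -, rfl⟩ := Finset.mem_image.1 ha
      exact Finset.mem_Icc.2 (hg _ _ v.2.2)
    · rw [Finset.card_image_of_injective _ hinj']
      simp
  refine ⟨Function.extend spiderEdge (fun v => g v.1 v.2) 0, ?_, fun i j h =>
    spiderEdge_injective.extend_apply _ _ _⟩
  rw [ncard_edgeSet_spider, ← range_spiderEdge, ← Finset.coe_Icc, ← himage, Finset.coe_image,
    Finset.coe_univ, Set.image_univ]
  refine ⟨?_, ?_, ?_⟩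
  · rintro _ ⟨v, rfl⟩
    exact ⟨v, (spiderEdge_injective.extend_apply (fun v => g v.1 v.2) 0 v).symm⟩
  · rintro _ ⟨v, rfl⟩ _ ⟨w, rfl⟩ h
    simp only [spiderEdge_injective.extend_apply] at h
    exact congrArg _ (hinj' h)
  · rintro _ ⟨v, rfl⟩
    exact ⟨_, Set.mem_range_self v, spiderEdge_injective.extend_apply _ _ _⟩

/-- A proper colouring `c₀`, `c` of the spider by the vertex sums of the edge labels `g` gives a
local antimagic labeling using only those colours. -/
theorem exists_isLocalAntimagic_spider (hy : ∀ i, 0 < y i) (g c : (i : Fin d) → ℕ → ℕ) (c₀ : ℕ)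
    (hg : ∀ i, ∀ j < y i, 1 ≤ g i j ∧ g i j ≤ ∑ i, y i)
    (hinj : ∀ i, ∀ j < y i, ∀ i', ∀ j' < y i', g i j = g i' j' → i = i' ∧ j = j')
    (hcore : ∑ i, g i 0 = c₀)
    (hinner : ∀ i j, j + 1 < y i → g i j + g i (j + 1) = c i j)
    (hleaf : ∀ i j, j + 1 = y i → g i j = c i j)
    (hc₀ : ∀ i, c₀ ≠ c i 0)
    (hc : ∀ i j, j + 1 < y i → c i j ≠ c i (j + 1)) :
    ∃ f, IsLocalAntimagic (spider d y) f ∧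
      Set.range (vertexSum (spider d y) f) ⊆ insert c₀ {a | ∃ i, ∃ j < y i, c i j = a} := by
  obtain ⟨f, hf, hfg⟩ := exists_bijOn_edgeSet_spider g hg hinj
  have hnone : vertexSum (spider d y) f none = c₀ := by
    simp only [vertexSum_spider_core hy, hfg, hcore]
  have hsome (i : Fin d) (j : ℕ) (hj : j < y i) :
      vertexSum (spider d y) f (some ⟨i, ⟨j, hj⟩⟩) = c i j := by
    rcases Nat.lt_or_eq_of_le (Nat.succ_le_of_lt hj) with h | h
    · rw [vertexSum_spider_inner f i j h, hfg, hfg, hinner i j h]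
    · rw [vertexSum_spider_leaf f i j h, hfg, hleaf i j h]
  have hparent (w : Σ i : Fin d, Fin (y i)) :
      vertexSum (spider d y) f (spiderParent w) ≠ vertexSum (spider d y) f (some w) := by
    obtain ⟨i, ⟨_ | j, hj⟩⟩ := w
    · rw [show spiderParent ⟨i, ⟨0, hj⟩⟩ = none from rfl, hnone, hsome]
      exact hc₀ i
    · rw [show spiderParent ⟨i, ⟨j + 1, hj⟩⟩ = some ⟨i, ⟨j, by omega⟩⟩ from rfl, hsome, hsome]
      exact hc i j hj
  refine ⟨f, ⟨hf, fun u v huv => ?_⟩, ?_⟩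
  · rcases (spider_adj_iff u v).1 huv with ⟨w, rfl, rfl⟩ | ⟨w, rfl, rfl⟩
    · exact (hparent w).symm
    · exact hparent w
  · rintro _ ⟨_ | ⟨i, j, hj⟩, rfl⟩
    · exact Or.inl hnone
    · exact Or.inr ⟨i, j, hj, (hsome i j hj).symm⟩

/-- The label of the `j`-th edge, counted from the core, of the `i`-th leg of the spider
`Sp(2n+1, 2(n+k)+1, 4k-1)`. -/
def legLabel (n k : ℕ) : Fin 3 → ℕ → ℕ :=
  ![fun j => if j % 2 = 0 then n + k - j / 2 else 3 * n + 5 * k + 1 + j / 2,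
    fun j => if j = 2 * (n + k) then 4 * n + 6 * k + 1
      else if j % 2 = 0 then 2 * n + 3 * k - j / 2 else 2 * n + 3 * k + 1 + j / 2,
    fun j => if j < 2 * k then
        if j % 2 = 0 then n + 2 * k - j / 2 else 3 * n + 4 * k + 1 + j / 2
      else if j % 2 = 0 then 4 * n + 4 * k + 1 + j / 2 else 2 * k - 1 - j / 2]

/-- The vertex sums of `legLabel n k` outside the core. -/
def legColor (n k : ℕ) : Fin 3 → ℕ → ℕ :=
  ![fun j => if j = 2 * n then k else 4 * n + 6 * k + (j + 1) % 2,
    fun j => if j + 1 = 2 * (n + k) then 7 * n + 10 * k + 1 else 4 * n + 6 * k + (j + 1) % 2,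
    fun j => if j < 2 * k - 1 then 4 * n + 6 * k + (j + 1) % 2
      else if j = 2 * k - 1 then 7 * n + 10 * k + 1 else 4 * n + 6 * k + j % 2]

end Spider

section LegLabel

variable {n k : ℕ}

/-- The leg lengths of the spider `Sp(2n+1, 2(n+k)+1, 4k-1)`. -/
abbrev legLength (n k : ℕ) : Fin 3 → ℕ := ![2 * n + 1, 2 * (n + k) + 1, 4 * k - 1]

theorem legLength_pos (hk : 0 < k) (i : Fin 3) : 0 < legLength n k i := by
  fin_cases i <;> simp only [Fin.reduceFinMk, Matrix.cons_val] <;> omega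

theorem legLabel_mem_Icc (hk : 0 < k) (i : Fin 3) (j : ℕ) (hj : j < legLength n k i) :
    1 ≤ legLabel n k i j ∧ legLabel n k i j ≤ ∑ i, legLength n k i := by
  rw [Fin.sum_univ_three]
  fin_cases i <;> simp only [Fin.reduceFinMk, legLabel, Matrix.cons_val] at hj ⊢ <;>
    split_ifs <;> omega

theorem legLabel_inj (i : Fin 3) (j : ℕ) (hj : j < legLength n k i) (i' : Fin 3) (j' : ℕ)
    (hj' : j' < legLength n k i') (h : legLabel n k i j = legLabel n k i' j') :
    i = i' ∧ j = j' := by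
  fin_cases i <;> fin_cases i' <;>
    simp only [Fin.reduceFinMk, legLabel, Matrix.cons_val, Fin.reduceEq, true_and,
      false_and] at hj hj' h ⊢ <;>
    split_ifs at h <;> omega

theorem sum_legLabel_zero (hk : 0 < k) : ∑ i, legLabel n k i 0 = 4 * n + 6 * k := by
  simp only [Fin.sum_univ_three, legLabel, Matrix.cons_val]
  split_ifs <;> omega

theorem legLabel_add_succ (i : Fin 3) (j : ℕ) (hj : j + 1 < legLength n k i) :
    legLabel n k i j + legLabel n k i (j + 1) = legColor n k i j := by
  fin_cases i <;> simp only [Fin.reduceFinMk, legLabel, legColor, Matrix.cons_val] at hj ⊢ <;>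
    split_ifs <;> omega

theorem legLabel_last (hk : 0 < k) (i : Fin 3) (j : ℕ) (hj : j + 1 = legLength n k i) :
    legLabel n k i j = legColor n k i j := by
  fin_cases i <;> simp only [Fin.reduceFinMk, legLabel, legColor, Matrix.cons_val] at hj ⊢ <;>
    split_ifs <;> omega

theorem core_ne_legColor (hk : 0 < k) (i : Fin 3) : 4 * n + 6 * k ≠ legColor n k i 0 := by
  fin_cases i <;> simp only [Fin.reduceFinMk, legColor, Matrix.cons_val] <;>
    split_ifs <;> omega

theorem legColor_ne_succ (hk : 0 < k) (i : Fin 3) (j : ℕ) :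
    legColor n k i j ≠ legColor n k i (j + 1) := by
  fin_cases i <;> simp only [Fin.reduceFinMk, legColor, Matrix.cons_val] <;>
    split_ifs <;> omega

theorem legColor_mem (i : Fin 3) (j : ℕ) :
    legColor n k i j ∈
      ({k, 4 * n + 6 * k, 4 * n + 6 * k + 1, 7 * n + 10 * k + 1} : Finset ℕ) := by
  simp only [Finset.mem_insert, Finset.mem_singleton]
  fin_cases i <;> simp only [Fin.reduceFinMk, legColor, Matrix.cons_val] <;>
    split_ifs <;> omega

end LegLabel

theorem stmt19 (m n : ℕ) (h : n < m) :
    chiLA (spider 3 ![2 * n + 1, 2 * m + 1, 4 * (m - n) - 1]) = 4 := by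
  obtain ⟨k, hk, rfl⟩ : ∃ k, 0 < k ∧ m = n + k := ⟨m - n, by omega, by omega⟩
  rw [Nat.add_sub_cancel_left]
  change chiLA (spider 3 (legLength n k)) = 4
  have hy := legLength_pos (n := n) hk
  obtain ⟨f, hf, hrange⟩ := exists_isLocalAntimagic_spider hy (legLabel n k) (legColor n k)
    (4 * n + 6 * k) (legLabel_mem_Icc hk) legLabel_inj (sum_legLabel_zero hk) legLabel_add_succ
    (legLabel_last hk) (core_ne_legColor hk) fun i j _ => legColor_ne_succ hk i j
  have hle : colorCount (spider 3 (legLength n k)) f ≤ 4 := by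
    have hsub : Set.range (vertexSum (spider 3 (legLength n k)) f) ⊆
        ({k, 4 * n + 6 * k, 4 * n + 6 * k + 1, 7 * n + 10 * k + 1} : Finset ℕ) := by
      refine hrange.trans ?_
      rintro a (rfl | ⟨i, j, -, rfl⟩)
      · simp
      · exact legColor_mem i j
    exact (Set.ncard_le_ncard hsub).trans ((Set.ncard_coe_finset _).trans_le Finset.card_le_four)
  have hmem : 4 ∈ {c | ∃ f, IsLocalAntimagic (spider 3 (legLength n k)) f ∧
      colorCount (spider 3 (legLength n k)) f = c} :=
    ⟨f, hf, hle.antisymm (succ_le_colorCount_spider (by norm_num) hy hf)⟩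
  refine (Nat.sInf_le hmem).antisymm (le_csInf ⟨4, hmem⟩ ?_)
  rintro _ ⟨f', hf', rfl⟩
  exact succ_le_colorCount_spider (by norm_num) hy hf'
end
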